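/- Let a ≥ 1 and k ≥ 4 be integers with k even, and set b = ak+2. Let T be any tree with exactly k interior (non-leaf) vertices and b leaves. Then λ₁(T) ≤ σ₃(a,k) = (k + 4a + 2 − √((k+2)² − 16))/4, and equality holds if and only if T is isomorphic to one of the star-like path trees SLP(a+1, a; 1; (k−2)/2, (k−2)/2), SLP(a+1, a; 2; (k−4)/2, (k−2)/2), or SLP(a+1, a; 3; (k−4)/2, (k−4)/2). -/

import Mathlib

open scoped Classical
open Finset

/-- The Dirichlet energy `∑_{{x,y} ∈ E} (f(x) - f(y))²` of a function on the vertices,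
computed as half of the sum over ordered adjacent pairs. -/
noncomputable def dirichletForm {V : Type*} [Fintype V] (G : SimpleGraph V) (f : V → ℝ) : ℝ :=
  (∑ x : V, ∑ y : V, if G.Adj x y then (f x - f y) ^ 2 else 0) / 2

/-- The first Dirichlet eigenvalue of a graph `G` with boundary `B`:
the infimum of Rayleigh quotients of nonzero functions vanishing on `B`. -/
noncomputable def lambda1 {V : Type*} [Fintype V] (G : SimpleGraph V) (B : Finset V) : ℝ :=
  sInf { r : ℝ | ∃ f : V → ℝ, (∀ x ∈ B, f x = 0) ∧ f ≠ 0 ∧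
    r = dirichletForm G f / ∑ x ∈ Bᶜ, f x ^ 2 }

/-- The distance from a vertex to a set of vertices. -/
noncomputable def distToSet {V : Type*} (G : SimpleGraph V) (B : Finset V) (v : V) : ℕ :=
  sInf { n : ℕ | ∃ b ∈ B, G.dist v b = n }

/-- The inscribed radius of a graph with boundary: `max_{v ∈ V} dist(v, B)`. -/
noncomputable def inradius {V : Type*} [Fintype V] (G : SimpleGraph V) (B : Finset V) : ℕ :=
  Finset.univ.sup fun v => distToSet G B v

/-- The diameter of a graph: `max_{v,w ∈ V} dist(v, w)`. -/
noncomputable def graphDiam {V : Type*} [Fintype V] (G : SimpleGraph V) : ℕ :=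
  Finset.univ.sup fun v => Finset.univ.sup fun w => G.dist v w

/-- The set of leaves (degree-one vertices) of a graph. -/
noncomputable def leaves {V : Type*} [Fintype V] (G : SimpleGraph V) : Finset V :=
  Finset.univ.filter fun v => G.degree v = 1

/-- Vertex type of the star-like path tree `SLP(p, q; c; d, e)`:
`path i` are the path vertices `u₀, …, u_c`; `dbr i` are the vertices `u_{0,i}` attached
to `u₀`; `ebr j` are the vertices `u_{c,j}` attached to `u_c`; `pleaf0` are the `p`
pendant leaves at `u₀`; `pleafc` are the `p` pendant leaves at `u_c` (absent when
`c = 0`, since then `u_c = u₀`); `qleafD i m`, `qleafE j m`, `qleafM m m'` are the `q`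
pendant leaves at `u_{0,i}`, at `u_{c,j}`, and at the interior path vertex `u_{m+1}`
(`1 ≤ m+1 ≤ c-1`), respectively. -/
inductive SLPVert (p q c d e : ℕ) : Type where
  | path : Fin (c + 1) → SLPVert p q c d e
  | dbr : Fin d → SLPVert p q c d e
  | ebr : Fin e → SLPVert p q c d e
  | pleaf0 : Fin p → SLPVert p q c d e
  | pleafc : Fin (if c = 0 then 0 else p) → SLPVert p q c d e
  | qleafD : Fin d → Fin q → SLPVert p q c d e
  | qleafE : Fin e → Fin q → SLPVert p q c d e
  | qleafM : Fin (c - 1) → Fin q → SLPVert p q c d e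
deriving DecidableEq, Fintype

/-- Base relation generating the edges of the star-like path tree. -/
def SLPRel {p q c d e : ℕ} : SLPVert p q c d e → SLPVert p q c d e → Prop
  | .path i, .path j => (i : ℕ) + 1 = (j : ℕ)
  | .path i, .dbr _ => (i : ℕ) = 0
  | .path i, .ebr _ => (i : ℕ) = c
  | .path i, .pleaf0 _ => (i : ℕ) = 0
  | .path i, .pleafc _ => (i : ℕ) = c
  | .path i, .qleafM m _ => (i : ℕ) = (m : ℕ) + 1
  | .dbr i, .qleafD i' _ => i = i'
  | .ebr j, .qleafE j' _ => j = j'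
  | _, _ => False

/-- The star-like path tree `SLP(p, q; c; d, e)`. -/
def SLP (p q c d e : ℕ) : SimpleGraph (SLPVert p q c d e) :=
  SimpleGraph.fromRel SLPRel

/-- `σ₃(a,k) = (k + 4a + 2 − √((k+2)² − 16)) / 4`. -/
noncomputable def sigma3 (a k : ℕ) : ℝ :=
  ((k : ℝ) + 4 * a + 2 - Real.sqrt (((k : ℝ) + 2) ^ 2 - 16)) / 4

section Laplacian

variable {V : Type*} [Fintype V]

/-- The graph Laplacian `(Δf)(v) = ∑_{y ∼ v} (f(v) - f(y))`. -/
noncomputable def graphLap (G : SimpleGraph V) (f : V → ℝ) (v : V) : ℝ :=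
  ∑ y : V, if G.Adj v y then f v - f y else 0

theorem sum_mul_graphLap (G : SimpleGraph V) (f g : V → ℝ) :
    ∑ x, f x * graphLap G g x =
      (∑ x, ∑ y, if G.Adj x y then (f x - f y) * (g x - g y) else 0) / 2 := by
  have h1 : ∑ x, f x * graphLap G g x =
      ∑ x, ∑ y, if G.Adj x y then f x * (g x - g y) else 0 := by
    simp only [graphLap, Finset.mul_sum, mul_ite, mul_zero]
  have h2 : ∑ x, f x * graphLap G g x =
      ∑ x, ∑ y, if G.Adj x y then f y * (g y - g x) else 0 := by
    rw [h1, Finset.sum_comm]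
    simp only [G.adj_comm]
  have h3 : (∑ x, ∑ y, if G.Adj x y then (f x - f y) * (g x - g y) else 0) =
      (∑ x, ∑ y, if G.Adj x y then f x * (g x - g y) else 0) +
      ∑ x, ∑ y, if G.Adj x y then f y * (g y - g x) else 0 := by
    simp only [← Finset.sum_add_distrib]
    refine Finset.sum_congr rfl fun x _ => Finset.sum_congr rfl fun y _ => ?_
    split_ifs <;> ring
  rw [h3, ← h1, ← h2]
  ring

theorem dirichletForm_eq_sum_mul_graphLap (G : SimpleGraph V) (f : V → ℝ) :
    dirichletForm G f = ∑ x, f x * graphLap G f x := by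
  rw [sum_mul_graphLap, dirichletForm]
  simp only [sq]

theorem sum_mul_graphLap_comm (G : SimpleGraph V) (f g : V → ℝ) :
    ∑ x, f x * graphLap G g x = ∑ x, g x * graphLap G f x := by
  rw [sum_mul_graphLap, sum_mul_graphLap]
  simp only [mul_comm]

theorem graphLap_add (G : SimpleGraph V) (f g : V → ℝ) (v : V) :
    graphLap G (f + g) v = graphLap G f v + graphLap G g v := by
  simp only [graphLap, ← Finset.sum_add_distrib, Pi.add_apply]
  refine Finset.sum_congr rfl fun y _ => ?_
  split_ifs <;> ring

theorem graphLap_single_self (G : SimpleGraph V) (v : V) (t : ℝ) :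
    graphLap G (Pi.single v t) v = G.degree v * t := by
  have h : ∀ y, (if G.Adj v y then (Pi.single v t : V → ℝ) v - (Pi.single v t : V → ℝ) y else 0)
      = if G.Adj v y then t else 0 := by
    intro y
    split_ifs with hy
    · simp [hy.ne']
    · rfl
  rw [graphLap, Finset.sum_congr rfl fun y _ => h y, ← Finset.sum_filter, Finset.sum_const,
    nsmul_eq_mul, ← G.card_neighborFinset_eq_degree, G.neighborFinset_eq_filter]

theorem graphLap_single_of_ne (G : SimpleGraph V) {v r : V} (h : v ≠ r) (t : ℝ) :
    graphLap G (Pi.single r t) v = if G.Adj v r then -t else 0 := by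
  rw [graphLap, Finset.sum_eq_single r]
  · simp [h]
  · intro y _ hy
    simp [h, hy]
  · simp

/-- The excess of the Dirichlet energy over `σ ‖f‖²`. -/
noncomputable def excess (G : SimpleGraph V) (σ : ℝ) (f : V → ℝ) : ℝ :=
  dirichletForm G f - σ * ∑ x, f x ^ 2

theorem excess_eq_sum (G : SimpleGraph V) (σ : ℝ) (f : V → ℝ) :
    excess G σ f = ∑ x, f x * (graphLap G f x - σ * f x) := by
  rw [excess, dirichletForm_eq_sum_mul_graphLap, Finset.mul_sum, ← Finset.sum_sub_distrib]
  exact Finset.sum_congr rfl fun x _ => by ring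

theorem excess_add_single (G : SimpleGraph V) (σ : ℝ) (f : V → ℝ) (v : V) (t : ℝ) :
    excess G σ (f + Pi.single v t) =
      excess G σ f + 2 * t * (graphLap G f v - σ * f v) + t ^ 2 * (G.degree v - σ) := by
  have key : ∀ g : V → ℝ, ∑ x, (Pi.single v t : V → ℝ) x * g x = t * g v := by
    intro g
    rw [Finset.sum_eq_single v]
    · simp
    · intro y _ hy
      simp [hy]
    · simp
  have h1 : ∑ x, (f + Pi.single v t : V → ℝ) x ^ 2 = ∑ x, f x ^ 2 + 2 * (t * f v) + t * t := by
    have : ∀ x, (f + Pi.single v t : V → ℝ) x ^ 2 = f x ^ 2 + 2 * ((Pi.single v t : V → ℝ) x * f x)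
        + (Pi.single v t : V → ℝ) x * (Pi.single v t : V → ℝ) x := fun x => by
      simp only [Pi.add_apply]; ring
    simp only [this, Finset.sum_add_distrib, ← Finset.mul_sum, key, Pi.single_eq_same]
  have h2 : dirichletForm G (f + Pi.single v t) =
      dirichletForm G f + 2 * (t * graphLap G f v) + t * (G.degree v * t) := by
    simp only [dirichletForm_eq_sum_mul_graphLap, graphLap_add, Pi.add_apply, add_mul, mul_add,
      Finset.sum_add_distrib, key, graphLap_single_self]
    rw [sum_mul_graphLap_comm G f (Pi.single v t), key]
    ring
  rw [excess, excess, h1, h2]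
  ring

/-- Euler–Lagrange equation: a function of nonpositive excess is an eigenfunction if the excess
is nonnegative on all functions vanishing on the boundary. -/
theorem graphLap_eq_of_excess_nonneg (G : SimpleGraph V) (B : Finset V) (σ : ℝ)
    (hσ : ∀ g : V → ℝ, (∀ x ∈ B, g x = 0) → 0 ≤ excess G σ g)
    (f : V → ℝ) (hf : ∀ x ∈ B, f x = 0) (hle : excess G σ f ≤ 0) (v : V) (hv : v ∉ B) :
    graphLap G f v = σ * f v := by
  set R := graphLap G f v - σ * f v with hR
  set C := (G.degree v : ℝ) - σ with hC
  have h : ∀ t : ℝ, 0 ≤ 2 * t * R + t ^ 2 * C := by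
    intro t
    have h1 := hσ (f + Pi.single v t) (fun x hx => by
      have : x ≠ v := fun h => hv (h ▸ hx)
      simp [hf x hx, this])
    rw [excess_add_single] at h1
    linarith
  have hpos : 0 < |C| + 1 := by positivity
  have h1 := h (-R / (|C| + 1))
  have h2 : 2 * (-R / (|C| + 1)) * R + (-R / (|C| + 1)) ^ 2 * C
      = R ^ 2 / (|C| + 1) ^ 2 * (C - 2 * (|C| + 1)) := by
    field_simp
    ring
  rw [h2] at h1
  have h3 : C - 2 * (|C| + 1) < 0 := by
    have := le_abs_self C
    have := abs_nonneg C
    linarith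
  have h4 : R = 0 := by
    by_contra hne
    have : 0 < R ^ 2 / (|C| + 1) ^ 2 := by positivity
    nlinarith
  linarith

theorem sum_sq_compl (B : Finset V) (f : V → ℝ) (hf : ∀ x ∈ B, f x = 0) :
    ∑ x ∈ Bᶜ, f x ^ 2 = ∑ x, f x ^ 2 := by
  refine Finset.sum_subset (Finset.subset_univ _) fun x _ hx => ?_
  rw [hf x (by simpa using hx)]
  simp

theorem sum_sq_pos_of_ne_zero (f : V → ℝ) (hne : f ≠ 0) : 0 < ∑ x, f x ^ 2 := by
  obtain ⟨v, hv⟩ := Function.ne_iff.mp hne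
  exact Finset.sum_pos' (fun x _ => sq_nonneg _) ⟨v, Finset.mem_univ v, by
    have : f v ≠ 0 := hv
    positivity⟩

theorem dirichletForm_nonneg (G : SimpleGraph V) (f : V → ℝ) : 0 ≤ dirichletForm G f := by
  refine div_nonneg (Finset.sum_nonneg fun x _ => Finset.sum_nonneg fun y _ => ?_) (by norm_num)
  split_ifs <;> positivity

theorem lambda1_mul_le (G : SimpleGraph V) (B : Finset V) (f : V → ℝ)
    (hf : ∀ x ∈ B, f x = 0) : lambda1 G B * ∑ x, f x ^ 2 ≤ dirichletForm G f := by
  by_cases hne : f = 0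
  · simpa [hne] using dirichletForm_nonneg G 0
  rw [← le_div_iff₀ (sum_sq_pos_of_ne_zero f hne)]
  refine csInf_le ⟨0, ?_⟩ ⟨f, hf, hne, by rw [sum_sq_compl B f hf]⟩
  rintro r ⟨g, -, -, rfl⟩
  exact div_nonneg (dirichletForm_nonneg G g) (Finset.sum_nonneg fun x _ => sq_nonneg _)

theorem lambda1_le_of_excess_nonpos (G : SimpleGraph V) (B : Finset V) (σ : ℝ) (f : V → ℝ)
    (hf : ∀ x ∈ B, f x = 0) (hne : f ≠ 0) (hle : excess G σ f ≤ 0) : lambda1 G B ≤ σ := by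
  have h1 := lambda1_mul_le G B f hf
  have h2 := sum_sq_pos_of_ne_zero f hne
  rw [excess] at hle
  exact le_of_mul_le_mul_right (by linarith) h2

theorem le_lambda1_of_excess_nonneg (G : SimpleGraph V) (B : Finset V) (σ : ℝ) (hB : Bᶜ.Nonempty)
    (h : ∀ g : V → ℝ, (∀ x ∈ B, g x = 0) → 0 ≤ excess G σ g) : σ ≤ lambda1 G B := by
  obtain ⟨v, hv⟩ := hB
  refine le_csInf ⟨_, Pi.single v 1, ?_, ?_, rfl⟩ ?_
  · intro x hx
    have : x ≠ v := by rintro rfl; simp [hx] at hv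
    simp [this]
  · intro h0
    simpa using congrFun h0 v
  · rintro r ⟨g, hg, hne, rfl⟩
    rw [sum_sq_compl B g hg, le_div_iff₀ (sum_sq_pos_of_ne_zero g hne)]
    have := h g hg
    rw [excess] at this
    linarith

theorem excess_nonneg_of_lambda1_eq {G : SimpleGraph V} {B : Finset V} {σ : ℝ}
    (h : lambda1 G B = σ) (g : V → ℝ) (hg : ∀ x ∈ B, g x = 0) : 0 ≤ excess G σ g := by
  have := lambda1_mul_le G B g hg
  rw [excess, ← h]
  linarith

end Laplacian

section StarLikePathTree

variable {p q c d e : ℕ}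

/-- A star-like path tree has its vertex set split according to the constructors. -/
def slpVertEquiv (p q c d e : ℕ) : SLPVert p q c d e ≃
    Fin (c + 1) ⊕ Fin d ⊕ Fin e ⊕ Fin p ⊕ Fin (if c = 0 then 0 else p) ⊕
      (Fin d × Fin q) ⊕ (Fin e × Fin q) ⊕ (Fin (c - 1) × Fin q) where
  toFun
    | .path i => .inl i
    | .dbr i => .inr (.inl i)
    | .ebr i => .inr (.inr (.inl i))
    | .pleaf0 i => .inr (.inr (.inr (.inl i)))
    | .pleafc i => .inr (.inr (.inr (.inr (.inl i))))
    | .qleafD i j => .inr (.inr (.inr (.inr (.inr (.inl (i, j))))))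
    | .qleafE i j => .inr (.inr (.inr (.inr (.inr (.inr (.inl (i, j)))))))
    | .qleafM i j => .inr (.inr (.inr (.inr (.inr (.inr (.inr (i, j)))))))
  invFun
    | .inl i => .path i
    | .inr (.inl i) => .dbr i
    | .inr (.inr (.inl i)) => .ebr i
    | .inr (.inr (.inr (.inl i))) => .pleaf0 i
    | .inr (.inr (.inr (.inr (.inl i)))) => .pleafc i
    | .inr (.inr (.inr (.inr (.inr (.inl x))))) => .qleafD x.1 x.2
    | .inr (.inr (.inr (.inr (.inr (.inr (.inl x)))))) => .qleafE x.1 x.2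
    | .inr (.inr (.inr (.inr (.inr (.inr (.inr x)))))) => .qleafM x.1 x.2
  left_inv x := by cases x <;> rfl
  right_inv x := by rcases x with x | x | x | x | x | x | x | x <;> rfl

theorem sum_slpVert (F : SLPVert p q c d e → ℝ) :
    ∑ x, F x = ∑ i, F (.path i) + (∑ i, F (.dbr i) + (∑ i, F (.ebr i) + (∑ i, F (.pleaf0 i) +
      (∑ i, F (.pleafc i) + (∑ i, ∑ j, F (.qleafD i j) + (∑ i, ∑ j, F (.qleafE i j) +
      ∑ i, ∑ j, F (.qleafM i j))))))) := by
  rw [← (slpVertEquiv p q c d e).symm.sum_comp]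
  simp only [Fintype.sum_sum_type, Fintype.sum_prod_type]
  rfl

theorem card_slpVert : Fintype.card (SLPVert p q c d e) =
    (c + 1) + (d + (e + (p + ((if c = 0 then 0 else p) + (d * q + (e * q + (c - 1) * q)))))) := by
  rw [Fintype.card_congr (slpVertEquiv p q c d e)]
  simp only [Fintype.card_sum, Fintype.card_prod, Fintype.card_fin]

theorem SLP_adj {x y : SLPVert p q c d e} :
    (SLP p q c d e).Adj x y ↔ x ≠ y ∧ (SLPRel x y ∨ SLPRel y x) := by
  rw [SLP, SimpleGraph.fromRel_adj]

theorem SLPRel.asymm {x y : SLPVert p q c d e} (h : SLPRel x y) : ¬ SLPRel y x := by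
  cases x <;> cases y <;> simp only [SLPRel] at h ⊢ <;> first | exact not_false | omega

theorem SLPRel.adj {x y : SLPVert p q c d e} (h : SLPRel x y) : (SLP p q c d e).Adj x y :=
  SLP_adj.2 ⟨by rintro rfl; exact h.asymm h, Or.inl h⟩

theorem SLPRel.mem_leaves {x y : SLPVert p q c d e} (h : SLPRel x y)
    (h1 : ∀ z, SLPRel z y → z = x) (h2 : ∀ z, ¬ SLPRel y z) : y ∈ leaves (SLP p q c d e) := by
  rw [leaves, Finset.mem_filter, SimpleGraph.degree_eq_one_iff_existsUnique_adj]
  refine ⟨Finset.mem_univ _, x, h.adj.symm, fun z hz => ?_⟩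
  rcases (SLP_adj.1 hz).2 with hz | hz
  · exact (h2 z hz).elim
  · exact h1 z hz

theorem pleaf0_mem_leaves (j : Fin p) : (.pleaf0 j : SLPVert p q c d e) ∈ leaves (SLP p q c d e) := by
  refine SLPRel.mem_leaves (x := .path 0) (by simp [SLPRel]) ?_ ?_ <;> intro z <;> cases z <;>
    simp [SLPRel]

theorem pleafc_mem_leaves (j) : (.pleafc j : SLPVert p q c d e) ∈ leaves (SLP p q c d e) := by
  refine SLPRel.mem_leaves (x := .path (Fin.last c)) (by simp [SLPRel]) ?_ ?_ <;> intro z <;>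
    cases z <;> simp [SLPRel, Fin.ext_iff]

theorem qleafD_mem_leaves (i j) : (.qleafD i j : SLPVert p q c d e) ∈ leaves (SLP p q c d e) := by
  refine SLPRel.mem_leaves (x := .dbr i) (by simp [SLPRel]) ?_ ?_ <;> intro z <;>
    cases z <;> simp [SLPRel]

theorem qleafE_mem_leaves (i j) : (.qleafE i j : SLPVert p q c d e) ∈ leaves (SLP p q c d e) := by
  refine SLPRel.mem_leaves (x := .ebr i) (by simp [SLPRel]) ?_ ?_ <;> intro z <;>
    cases z <;> simp [SLPRel]

theorem qleafM_mem_leaves (i j) : (.qleafM i j : SLPVert p q c d e) ∈ leaves (SLP p q c d e) := by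
  refine SLPRel.mem_leaves (x := .path ⟨i + 1, by omega⟩) (by simp [SLPRel]) ?_ ?_ <;> intro z <;>
    cases z <;> simp [SLPRel, Fin.ext_iff]

theorem dirichletForm_SLP (f : SLPVert p q c d e → ℝ) :
    dirichletForm (SLP p q c d e) f = ∑ x, ∑ y, if SLPRel x y then (f x - f y) ^ 2 else 0 := by
  have h : ∀ x y, (if (SLP p q c d e).Adj x y then (f x - f y) ^ 2 else 0) =
      (if SLPRel x y then (f x - f y) ^ 2 else 0) +
        (if SLPRel y x then (f y - f x) ^ 2 else 0) := by
    intro x y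
    by_cases h1 : SLPRel x y
    · simp [h1, h1.asymm, h1.adj]
    · by_cases h2 : SLPRel y x
      · simp only [h1, h2, h2.adj.symm, if_true, if_false]; ring
      · simp [SLP_adj, h1, h2]
  rw [dirichletForm]
  simp only [h, Finset.sum_add_distrib]
  rw [Finset.sum_comm (f := fun x y => if SLPRel y x then (f y - f x) ^ 2 else 0)]
  ring

theorem SLP_connected : (SLP p q c d e).Connected := by
  have hp : ∀ n (hn : n < c + 1), (SLP p q c d e).Reachable (.path 0) (.path ⟨n, hn⟩) := by
    intro n
    induction n with
    | zero => intro _; exact .refl _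
    | succ n ih =>
      intro hn
      refine (ih (by omega)).trans (SimpleGraph.Adj.reachable (SLPRel.adj ?_))
      simp [SLPRel]
  have hs : ∀ {x y : SLPVert p q c d e}, (SLP p q c d e).Reachable (.path 0) x → SLPRel x y →
      (SLP p q c d e).Reachable (.path 0) y := fun h1 h2 => h1.trans h2.adj.reachable
  have key : ∀ x, (SLP p q c d e).Reachable (.path 0) x := by
    have hd : ∀ i, (SLP p q c d e).Reachable (.path 0) (.dbr i) := fun i =>
      hs (.refl _) (by simp [SLPRel])
    have he : ∀ i, (SLP p q c d e).Reachable (.path 0) (.ebr i) := fun i =>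
      hs (hp c (by omega)) (by simp [SLPRel])
    rintro (⟨i, hi⟩ | i | i | i | i | ⟨i, j⟩ | ⟨i, j⟩ | ⟨i, j⟩)
    · exact hp i hi
    · exact hd i
    · exact he i
    · exact hs (.refl _) (by simp [SLPRel])
    · exact hs (hp c (by omega)) (by simp [SLPRel])
    · exact hs (hd i) (by simp [SLPRel])
    · exact hs (he i) (by simp [SLPRel])
    · exact hs (hp (i + 1) (by omega)) (by simp [SLPRel])
  exact (SimpleGraph.connected_iff _).2 ⟨fun x y => (key x).symm.trans (key y), ⟨.path 0⟩⟩

/-- The weighted star inequality: `x² + ∑ (x - yᵢ)² ≥ μ (x² + ∑ yᵢ²)` when the number `n` of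
branches satisfies `n μ ≤ (1 - μ)²`. -/
theorem star_energy_ge {ι : Type*} [Fintype ι] {μ : ℝ} (hμ : μ < 1)
    (hn : Fintype.card ι * μ ≤ (1 - μ) ^ 2) (x : ℝ) (y : ι → ℝ) :
    μ * x ^ 2 + μ * ∑ i, y i ^ 2 ≤ x ^ 2 + ∑ i, (x - y i) ^ 2 := by
  have h1 : (0 : ℝ) < 1 - μ := by linarith
  have h2 : ∀ i, -(μ / (1 - μ)) * x ^ 2 ≤ (x - y i) ^ 2 - μ * y i ^ 2 := by
    intro i
    have : (x - y i) ^ 2 - μ * y i ^ 2 - -(μ / (1 - μ)) * x ^ 2 =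
        ((1 - μ) * y i - x) ^ 2 / (1 - μ) := by
      field_simp
      ring
    have h3 : 0 ≤ ((1 - μ) * y i - x) ^ 2 / (1 - μ) := by positivity
    linarith
  have h3 := Finset.sum_le_sum fun i (_ : i ∈ Finset.univ) => h2 i
  rw [Finset.sum_const, Finset.card_univ, nsmul_eq_mul, Finset.sum_sub_distrib,
    ← Finset.mul_sum] at h3
  have h4 : Fintype.card ι * (μ / (1 - μ)) ≤ 1 - μ := by
    rw [← mul_div_assoc, div_le_iff₀ h1]
    linarith
  nlinarith [sq_nonneg x]

end StarLikePathTree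

section LowerBound

variable {a d : ℕ} {μ : ℝ}

theorem sum_sum_ite_eq {ι : Type*} [Fintype ι] (i : ι) (x : ℝ) :
    (∑ j : ι, ∑ _m : Fin a, if i = j then x else 0) = a * x := by
  rw [Finset.sum_comm]
  simp

theorem excess_SLP_one_nonneg (hμ : μ < 1) (hd : d * μ ≤ (1 - μ) ^ 2)
    (f : SLPVert (a + 1) a 1 d d → ℝ)
    (hf : ∀ x ∈ leaves (SLP (a + 1) a 1 d d), f x = 0) :
    0 ≤ excess (SLP (a + 1) a 1 d d) (a + μ) f := by
  have l1 := fun i => hf _ (pleaf0_mem_leaves i)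
  have l2 := fun i => hf _ (pleafc_mem_leaves i)
  have l3 := fun i j => hf _ (qleafD_mem_leaves i j)
  have l4 := fun i j => hf _ (qleafE_mem_leaves i j)
  have l5 := fun i j => hf _ (qleafM_mem_leaves i j)
  rw [excess, dirichletForm_SLP]
  simp [sum_slpVert, SLPRel, l1, l2, l3, l4, l5, Fin.sum_univ_succ, sum_sum_ite_eq,
    ← Finset.mul_sum]
  have h1 := star_energy_ge hμ (by simpa using hd) (f (.path 0)) fun i => f (.dbr i)
  have h2 := star_energy_ge hμ (by simpa using hd) (f (.path 1)) fun i => f (.ebr i)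
  nlinarith [sq_nonneg (f (.path 0) - f (.path 1))]

theorem excess_SLP_two_nonneg {e : ℕ} (hμ : μ < 1) (hd : ((d + 1 : ℕ) : ℝ) * μ ≤ (1 - μ) ^ 2)
    (he : e * μ ≤ (1 - μ) ^ 2)
    (f : SLPVert (a + 1) a 2 d e → ℝ)
    (hf : ∀ x ∈ leaves (SLP (a + 1) a 2 d e), f x = 0) :
    0 ≤ excess (SLP (a + 1) a 2 d e) (a + μ) f := by
  have l1 := fun i => hf _ (pleaf0_mem_leaves i)
  have l2 := fun i => hf _ (pleafc_mem_leaves i)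
  have l3 := fun i j => hf _ (qleafD_mem_leaves i j)
  have l4 := fun i j => hf _ (qleafE_mem_leaves i j)
  have l5 := fun i j => hf _ (qleafM_mem_leaves i j)
  rw [excess, dirichletForm_SLP]
  have h1 := star_energy_ge hμ (by simpa using hd) (f (.path 0))
    (Fin.cons (f (.path 1)) fun i : Fin d => f (.dbr i))
  have h2 := star_energy_ge hμ (by simpa using he) (f (.path 2)) fun i : Fin e => f (.ebr i)
  simp [sum_slpVert, SLPRel, l1, l2, l3, l4, l5, Fin.sum_univ_succ, sum_sum_ite_eq,
    ← Finset.mul_sum] at h1 h2 ⊢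
  nlinarith [sq_nonneg (f (.path 1) - f (.path 2))]

theorem excess_SLP_three_nonneg (hμ : μ < 1) (hd : ((d + 1 : ℕ) : ℝ) * μ ≤ (1 - μ) ^ 2)
    (f : SLPVert (a + 1) a 3 d d → ℝ)
    (hf : ∀ x ∈ leaves (SLP (a + 1) a 3 d d), f x = 0) :
    0 ≤ excess (SLP (a + 1) a 3 d d) (a + μ) f := by
  have l1 := fun i => hf _ (pleaf0_mem_leaves i)
  have l2 := fun i => hf _ (pleafc_mem_leaves i)
  have l3 := fun i j => hf _ (qleafD_mem_leaves i j)
  have l4 := fun i j => hf _ (qleafE_mem_leaves i j)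
  have l5 := fun i j => hf _ (qleafM_mem_leaves i j)
  rw [excess, dirichletForm_SLP]
  have h1 := star_energy_ge hμ (by simpa using hd) (f (.path 0))
    (Fin.cons (f (.path 1)) fun i : Fin d => f (.dbr i))
  have h2 := star_energy_ge hμ (by simpa using hd) (f (.path 3))
    (Fin.cons (f (.path 2)) fun i : Fin d => f (.ebr i))
  simp [sum_slpVert, SLPRel, l1, l2, l3, l4, l5, Fin.sum_univ_succ, sum_sum_ite_eq,
    ← Finset.mul_sum] at h1 h2 ⊢
  nlinarith [sq_nonneg (f (.path 1) - f (.path 2))]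

end LowerBound

section Isomorphism

theorem map_mem_leaves_iff {V W : Type*} [Fintype V] [Fintype W] {G : SimpleGraph V}
    {H : SimpleGraph W} (φ : G ≃g H) (v : V) : φ v ∈ leaves H ↔ v ∈ leaves G := by
  simp only [leaves, Finset.mem_filter, Finset.mem_univ, true_and, φ.degree_eq]

theorem excess_nonneg_of_iso {V W : Type*} [Fintype V] [Fintype W] {G : SimpleGraph V}
    {H : SimpleGraph W} (φ : G ≃g H) {σ : ℝ}
    (h : ∀ f : W → ℝ, (∀ x ∈ leaves H, f x = 0) → 0 ≤ excess H σ f)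
    (g : V → ℝ) (hg : ∀ x ∈ leaves G, g x = 0) : 0 ≤ excess G σ g := by
  convert h (fun w => g (φ.symm w)) fun x hx => hg _ ((map_mem_leaves_iff φ.symm x).2 hx) using 1
  simp only [excess, dirichletForm]
  rw [← φ.toEquiv.sum_comp (fun x => g (φ.symm x) ^ 2), ← φ.toEquiv.sum_comp]
  simp_rw [← φ.toEquiv.sum_comp]
  simp [φ.map_adj_iff]

/-- The leaves adjacent to `v`. -/
noncomputable def leafNbrs {V : Type*} [Fintype V] (G : SimpleGraph V) (v : V) : Finset V :=
  (leaves G).filter (G.Adj v)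

/-- The interior vertices adjacent to `v`. -/
noncomputable def intNbrs {V : Type*} [Fintype V] (G : SimpleGraph V) (v : V) : Finset V :=
  (leaves G)ᶜ.filter (G.Adj v)

theorem exists_surjOn_of_card_eq {V : Type*} {s : Finset V} {n : ℕ} (h : s.card = n) :
    ∃ φ : Fin n → V, (∀ i, φ i ∈ s) ∧ ∀ v ∈ s, ∃ i, φ i = v := by
  subst h
  exact ⟨fun i => (s.equivFin.symm i : V), fun i => (s.equivFin.symm i).2,
    fun v hv => ⟨s.equivFin ⟨v, hv⟩, by simp⟩⟩

/-- A tree with the same number of vertices as a star-like path tree, and the same local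
description, is isomorphic to it. -/
theorem nonempty_iso_SLP {V : Type*} [Fintype V] {T : SimpleGraph V} (hT : T.IsTree)
    {p q c d e : ℕ} (hc : c ≠ 0)
    (hcard : Fintype.card V = Fintype.card (SLPVert p q c d e))
    (P : Fin (c + 1) → V) (D E : Finset V) (hD : D.card = d) (hE : E.card = e)
    (hP : ∀ i j : Fin (c + 1), (i : ℕ) + 1 = j → T.Adj (P i) (P j))
    (hPD : ∀ v ∈ D, T.Adj (P 0) v) (hPE : ∀ v ∈ E, T.Adj (P (Fin.last c)) v)
    (hcover : ∀ v ∉ leaves T, v ∈ D ∨ v ∈ E ∨ ∃ i, P i = v)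
    (hleaf : ∀ v ∈ leaves T, ∃ u ∉ leaves T, T.Adj u v)
    (hp0 : (leafNbrs T (P 0)).card = p) (hpc : (leafNbrs T (P (Fin.last c))).card = p)
    (hqP : ∀ i : Fin (c - 1), (leafNbrs T (P ⟨i + 1, by omega⟩)).card = q)
    (hqD : ∀ v ∈ D, (leafNbrs T v).card = q) (hqE : ∀ v ∈ E, (leafNbrs T v).card = q) :
    Nonempty (T ≃g SLP p q c d e) := by
  obtain ⟨D', hD', hD''⟩ := exists_surjOn_of_card_eq hD
  obtain ⟨E', hE', hE''⟩ := exists_surjOn_of_card_eq hE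
  obtain ⟨L0, h0, h0'⟩ := exists_surjOn_of_card_eq hp0
  have hpc' : (leafNbrs T (P (Fin.last c))).card = if c = 0 then 0 else p := by simp [hc, hpc]
  obtain ⟨Lc, hc1, hc2⟩ := exists_surjOn_of_card_eq hpc'
  choose LP hLP hLP' using fun i => exists_surjOn_of_card_eq (hqP i)
  choose LD hLD hLD' using fun i => exists_surjOn_of_card_eq (hqD (D' i) (hD' i))
  choose LE hLE hLE' using fun i => exists_surjOn_of_card_eq (hqE (E' i) (hE' i))
  have hadj : ∀ {u v}, v ∈ leafNbrs T u → T.Adj u v := fun h => (Finset.mem_filter.1 h).2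
  let φ : SLPVert p q c d e → V
    | .path i => P i
    | .dbr i => D' i
    | .ebr i => E' i
    | .pleaf0 i => L0 i
    | .pleafc i => Lc i
    | .qleafD i j => LD i j
    | .qleafE i j => LE i j
    | .qleafM i j => LP i j
  have hrel : ∀ x y, SLPRel x y → T.Adj (φ x) (φ y) := by
    intro x y h
    cases x with
    | path i =>
      have hi0 : (i : ℕ) = 0 → i = 0 := fun h => Fin.ext h
      have hic : (i : ℕ) = c → i = Fin.last c := fun h => Fin.ext h
      cases y with
      | path j => exact hP i j h
      | dbr j => rw [hi0 h]; exact hPD _ (hD' j)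
      | ebr j => rw [hic h]; exact hPE _ (hE' j)
      | pleaf0 j => rw [hi0 h]; exact hadj (h0 j)
      | pleafc j => rw [hic h]; exact hadj (hc1 j)
      | qleafM m j =>
        have : i = ⟨m + 1, by omega⟩ := Fin.ext h
        rw [this]; exact hadj (hLP m j)
      | qleafD => exact h.elim
      | qleafE => exact h.elim
    | dbr i =>
      cases y with
      | qleafD j m => obtain rfl : i = j := h; exact hadj (hLD i m)
      | _ => exact h.elim
    | ebr i =>
      cases y with
      | qleafE j m => obtain rfl : i = j := h; exact hadj (hLE i m)
      | _ => exact h.elim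
    | _ => exact h.elim
  have hhom : ∀ x y, (SLP p q c d e).Adj x y → T.Adj (φ x) (φ y) := fun x y h =>
    (SLP_adj.1 h).2.elim (hrel x y) fun h => (hrel y x h).symm
  have hsurj : Function.Surjective φ := by
    intro v
    by_cases hv : v ∈ leaves T
    · obtain ⟨u, hu, huv⟩ := hleaf v hv
      have hmem : v ∈ leafNbrs T u := Finset.mem_filter.2 ⟨hv, huv⟩
      rcases hcover u hu with h | h | ⟨i, rfl⟩
      · obtain ⟨i, rfl⟩ := hD'' u h
        obtain ⟨j, rfl⟩ := hLD' i v hmem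
        exact ⟨.qleafD i j, rfl⟩
      · obtain ⟨i, rfl⟩ := hE'' u h
        obtain ⟨j, rfl⟩ := hLE' i v hmem
        exact ⟨.qleafE i j, rfl⟩
      · by_cases hi0 : i = 0
        · subst hi0
          obtain ⟨j, rfl⟩ := h0' v hmem
          exact ⟨.pleaf0 j, rfl⟩
        by_cases hic : i = Fin.last c
        · subst hic
          obtain ⟨j, rfl⟩ := hc2 v hmem
          exact ⟨.pleafc j, rfl⟩
        have h1 : (i : ℕ) ≠ 0 := fun h => hi0 (Fin.ext h)
        have h2 : (i : ℕ) ≠ c := fun h => hic (Fin.ext h)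
        have h3 : i = ⟨((⟨i - 1, by omega⟩ : Fin (c - 1)) : ℕ) + 1, by simp; omega⟩ :=
          Fin.ext (by simp; omega)
        rw [h3] at hmem
        obtain ⟨j, rfl⟩ := hLP' _ v hmem
        exact ⟨.qleafM _ j, rfl⟩
    · rcases hcover v hv with h | h | ⟨i, rfl⟩
      · obtain ⟨i, rfl⟩ := hD'' v h
        exact ⟨.dbr i, rfl⟩
      · obtain ⟨i, rfl⟩ := hE'' v h
        exact ⟨.ebr i, rfl⟩
      · exact ⟨.path i, rfl⟩
  have hbij : Function.Bijective φ :=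
    (Fintype.bijective_iff_surjective_and_card φ).2 ⟨hsurj, hcard.symm⟩
  let ψ : SLPVert p q c d e ≃ V := Equiv.ofBijective φ hbij
  let ι : T.comap ψ ≃g T := SimpleGraph.Iso.comap ψ T
  have htree : (T.comap ψ).IsTree := ι.isTree_iff.2 hT
  have heq : SLP p q c d e = T.comap ψ := by
    refine le_antisymm (fun x y h => hhom x y h) ?_
    exact (SimpleGraph.isTree_iff_minimal_connected.1 htree).2 SLP_connected
      (fun x y h => hhom x y h)
  rw [heq]
  exact ⟨ι.symm⟩

end Isomorphism

section TreeFacts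

variable {V : Type*} {T : SimpleGraph V}

theorem SimpleGraph.IsTree.not_triangle (hT : T.IsTree) {x y z : V} (hxy : T.Adj x y)
    (hyz : T.Adj y z) : ¬ T.Adj x z := by
  intro hxz
  have h := (hT.isAcyclic.subsingleton_path _ _).elim ⟨.cons hxz .nil, by simp [hxz.ne]⟩
    ⟨.cons hxy (.cons hyz .nil), by simp [hxy.ne, hyz.ne, hxz.ne]⟩
  simpa using congrArg (fun p => p.1.length) h

theorem SimpleGraph.IsTree.common_nbr_unique (hT : T.IsTree) {x y u v : V} (hxy : x ≠ y)
    (hxu : T.Adj x u) (huy : T.Adj u y) (hxv : T.Adj x v) (hvy : T.Adj v y) : u = v := by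
  have h := (hT.isAcyclic.subsingleton_path _ _).elim
    ⟨.cons hxu (.cons huy .nil), by simp [hxu.ne, huy.ne, hxy]⟩
    ⟨.cons hxv (.cons hvy .nil), by simp [hxv.ne, hvy.ne, hxy]⟩
  simpa using congrArg (fun p => p.1.support) h

theorem SimpleGraph.IsTree.not_pentagon (hT : T.IsTree) {r s t u v : V} (hrs : r ≠ s)
    (hrt : T.Adj r t) (hts : T.Adj t s) (hru : T.Adj r u) (hvs : T.Adj v s) : ¬ T.Adj u v := by
  intro huv
  have hn : ¬ T.Adj r s := hT.not_triangle hrt hts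
  have h1 : u ≠ s := by rintro rfl; exact hn hru
  have h2 : r ≠ v := by rintro rfl; exact hn hvs
  have h := (hT.isAcyclic.subsingleton_path _ _).elim
    ⟨.cons hrt (.cons hts .nil), by simp [hrt.ne, hts.ne, hrs]⟩
    ⟨.cons hru (.cons huv (.cons hvs .nil)), by simp [hru.ne, huv.ne, hvs.ne, hrs, h1, h2]⟩
  simpa using congrArg (fun p => p.1.length) h

theorem exists_boundary_edge (hT : T.Connected) {S : Set V} {u v : V} (hu : u ∈ S) (hv : v ∉ S) :
    ∃ x ∈ S, ∃ y ∉ S, T.Adj x y := by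
  obtain ⟨w⟩ := hT.preconnected u v
  obtain ⟨d, -, h1, h2⟩ := w.exists_boundary_dart S hu hv
  exact ⟨_, h1, _, h2, d.adj⟩

variable [Fintype V]

theorem eq_of_adj_of_mem_leaves {v x y : V} (hv : v ∈ leaves T) (hx : T.Adj v x)
    (hy : T.Adj v y) : x = y := by
  rw [leaves, Finset.mem_filter, SimpleGraph.degree_eq_one_iff_existsUnique_adj] at hv
  exact hv.2.unique hx hy

theorem exists_interior_adj_leaf (hT : T.Connected) (hne : (leaves T)ᶜ.Nonempty) {v : V}
    (hv : v ∈ leaves T) : ∃ u ∉ leaves T, T.Adj u v := by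
  obtain ⟨x, hx⟩ := hne
  rw [Finset.mem_compl] at hx
  have hv' := hv
  rw [leaves, Finset.mem_filter, SimpleGraph.degree_eq_one_iff_existsUnique_adj] at hv'
  obtain ⟨u, hu, -⟩ := hv'.2
  refine ⟨u, fun hul => ?_, hu.symm⟩
  obtain ⟨y, hy, z, hz, hyz⟩ := exists_boundary_edge hT (S := {v, u}) (u := v) (v := x) (by simp)
    (by rintro (rfl | rfl) <;> contradiction)
  rcases hy with rfl | rfl
  · exact hz (by simp [eq_of_adj_of_mem_leaves hv hyz hu])
  · exact hz (by simp [eq_of_adj_of_mem_leaves hul hyz hu.symm])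

theorem mem_intNbrs {v u : V} : u ∈ intNbrs T v ↔ u ∉ leaves T ∧ T.Adj v u := by
  simp [intNbrs]

theorem degree_eq_card_add_card (v : V) :
    T.degree v = (leafNbrs T v).card + (intNbrs T v).card := by
  rw [← T.card_neighborFinset_eq_degree, T.neighborFinset_eq_filter, leafNbrs, intNbrs,
    ← Finset.card_union_of_disjoint, ← Finset.filter_union, Finset.union_compl]
  exact Finset.disjoint_filter_filter disjoint_compl_right

theorem sum_card_leafNbrs (hT : T.Connected) (hne : (leaves T)ᶜ.Nonempty) :
    ∑ v ∈ (leaves T)ᶜ, (leafNbrs T v).card = (leaves T).card := by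
  have h := Finset.sum_card_bipartiteAbove_eq_sum_card_bipartiteBelow (s := (leaves T)ᶜ)
    (t := leaves T) T.Adj
  have h2 : ∀ v ∈ leaves T, (Finset.bipartiteBelow T.Adj (leaves T)ᶜ v).card = 1 := by
    intro v hv
    obtain ⟨u, hu, huv⟩ := exists_interior_adj_leaf hT hne hv
    rw [Finset.card_eq_one]
    refine ⟨u, Finset.ext fun x => ?_⟩
    simp only [Finset.mem_bipartiteBelow, Finset.mem_compl, Finset.mem_singleton]
    constructor
    · exact fun hx => eq_of_adj_of_mem_leaves hv hx.2.symm huv.symm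
    · rintro rfl; exact ⟨hu, huv⟩
  rw [Finset.sum_congr rfl h2, Finset.sum_const, smul_eq_mul, mul_one] at h
  exact h

theorem graphLap_eq_of_vanish {f : V → ℝ} (hf : ∀ x ∈ leaves T, f x = 0) (v : V) :
    graphLap T f v = (leafNbrs T v).card * f v + ∑ y ∈ intNbrs T v, (f v - f y) := by
  rw [graphLap, ← Finset.sum_add_sum_compl (leaves T), leafNbrs, intNbrs, ← Finset.sum_filter,
    ← Finset.sum_filter]
  congr 1
  rw [Finset.sum_congr rfl (g := fun _ => f v), Finset.sum_const, nsmul_eq_mul]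
  intro x hx
  rw [hf x (Finset.mem_filter.1 hx).1, sub_zero]

/-- The indicator function of the interior. -/
noncomputable def interiorInd (T : SimpleGraph V) (v : V) : ℝ := if v ∈ leaves T then 0 else 1

theorem interiorInd_of_mem {v : V} (hv : v ∈ leaves T) : interiorInd T v = 0 := if_pos hv

theorem interiorInd_of_notMem {v : V} (hv : v ∉ leaves T) : interiorInd T v = 1 := if_neg hv

theorem graphLap_interiorInd {v : V} (hv : v ∉ leaves T) :
    graphLap T (interiorInd T) v = (leafNbrs T v).card := by
  rw [graphLap_eq_of_vanish fun x hx => interiorInd_of_mem hx, interiorInd_of_notMem hv,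
    Finset.sum_eq_zero, add_zero, mul_one]
  intro y hy
  rw [interiorInd_of_notMem (mem_intNbrs.1 hy).1, sub_self]

theorem excess_interiorInd (hT : T.Connected) (hne : (leaves T)ᶜ.Nonempty) (σ : ℝ) :
    excess T σ (interiorInd T) = (leaves T).card - σ * (leaves T)ᶜ.card := by
  rw [excess_eq_sum, ← Finset.sum_add_sum_compl (leaves T), Finset.sum_eq_zero, zero_add,
    Finset.sum_congr rfl (g := fun v => ((leafNbrs T v).card : ℝ) - σ), Finset.sum_sub_distrib,
    Finset.sum_const, nsmul_eq_mul, ← sum_card_leafNbrs hT hne]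
  · push_cast
    ring
  · intro v hv
    rw [Finset.mem_compl] at hv
    rw [graphLap_interiorInd hv, interiorInd_of_notMem hv]
    ring
  · intro v hv
    rw [interiorInd_of_mem hv, zero_mul]

/-- The test function equal to `1` on the interior except for the value `1 - μ` at `r`. -/
noncomputable def dipOne (T : SimpleGraph V) (μ : ℝ) (r : V) : V → ℝ :=
  interiorInd T + Pi.single r (-μ)

/-- The test function equal to `1` on the interior except for the value `1 - μ` at `r`
and at `s`. -/
noncomputable def dipTwo (T : SimpleGraph V) (μ : ℝ) (r s : V) : V → ℝ :=
  dipOne T μ r + Pi.single s (-μ)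

theorem dipTwo_comm (μ : ℝ) (r s : V) : dipTwo T μ r s = dipTwo T μ s r := by
  rw [dipTwo, dipTwo, dipOne, dipOne, add_right_comm]

variable {μ σ : ℝ} {r s : V}

theorem dipOne_vanish (hr : r ∉ leaves T) {x : V} (hx : x ∈ leaves T) : dipOne T μ r x = 0 := by
  have : x ≠ r := by rintro rfl; contradiction
  simp [dipOne, interiorInd_of_mem hx, this]

theorem dipTwo_vanish (hr : r ∉ leaves T) (hs : s ∉ leaves T) {x : V} (hx : x ∈ leaves T) :
    dipTwo T μ r s x = 0 := by
  have : x ≠ s := by rintro rfl; contradiction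
  simp [dipTwo, dipOne_vanish hr hx, this]

theorem dipOne_of_ne {v : V} (hv : v ∉ leaves T) (h : v ≠ r) : dipOne T μ r v = 1 := by
  simp [dipOne, interiorInd_of_notMem hv, h]

theorem dipOne_self (hr : r ∉ leaves T) : dipOne T μ r r = 1 - μ := by
  simp [dipOne, interiorInd_of_notMem hr, sub_eq_add_neg]

theorem dipTwo_of_ne {v : V} (hv : v ∉ leaves T) (h : v ≠ r) (h' : v ≠ s) :
    dipTwo T μ r s v = 1 := by
  simp [dipTwo, dipOne_of_ne hv h, h']

theorem dipTwo_left (hr : r ∉ leaves T) (hrs : r ≠ s) : dipTwo T μ r s r = 1 - μ := by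
  simp [dipTwo, dipOne_self hr, hrs]

theorem graphLap_dipOne_of_ne {v : V} (hv : v ∉ leaves T) (h : v ≠ r) :
    graphLap T (dipOne T μ r) v = (leafNbrs T v).card + if T.Adj v r then μ else 0 := by
  rw [dipOne, graphLap_add, graphLap_interiorInd hv, graphLap_single_of_ne _ h, neg_neg]

theorem graphLap_dipOne_self (hr : r ∉ leaves T) :
    graphLap T (dipOne T μ r) r =
      (leafNbrs T r).card - μ * ((leafNbrs T r).card + (intNbrs T r).card) := by
  rw [dipOne, graphLap_add, graphLap_interiorInd hr, graphLap_single_self, degree_eq_card_add_card]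
  push_cast
  ring

theorem graphLap_dipTwo_of_ne {v : V} (hv : v ∉ leaves T) (h : v ≠ r) (h' : v ≠ s) :
    graphLap T (dipTwo T μ r s) v = (leafNbrs T v).card + (if T.Adj v r then μ else 0) +
      if T.Adj v s then μ else 0 := by
  rw [dipTwo, graphLap_add, graphLap_dipOne_of_ne hv h, graphLap_single_of_ne _ h', neg_neg]

theorem graphLap_dipTwo_left (hr : r ∉ leaves T) (hrs : r ≠ s) :
    graphLap T (dipTwo T μ r s) r =
      (leafNbrs T r).card - μ * ((leafNbrs T r).card + (intNbrs T r).card) +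
        if T.Adj r s then μ else 0 := by
  rw [dipTwo, graphLap_add, graphLap_dipOne_self hr, graphLap_single_of_ne _ hrs, neg_neg]

theorem excess_dipOne (hT : T.Connected) (hr : r ∉ leaves T) :
    excess T σ (dipOne T μ r) = (leaves T).card - σ * (leaves T)ᶜ.card
      - 2 * μ * ((leafNbrs T r).card - σ)
      + μ ^ 2 * ((leafNbrs T r).card + (intNbrs T r).card - σ) := by
  rw [dipOne, excess_add_single, excess_interiorInd hT ⟨r, by simpa using hr⟩,
    graphLap_interiorInd hr, interiorInd_of_notMem hr, degree_eq_card_add_card]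
  push_cast
  ring

theorem excess_dipTwo (hT : T.Connected) (hr : r ∉ leaves T) (hs : s ∉ leaves T) (hrs : r ≠ s) :
    excess T σ (dipTwo T μ r s) = (leaves T).card - σ * (leaves T)ᶜ.card
      - 2 * μ * ((leafNbrs T r).card + (leafNbrs T s).card - 2 * σ)
      + μ ^ 2 * ((leafNbrs T r).card + (leafNbrs T s).card - 2 * σ)
      + μ ^ 2 * ((intNbrs T r).card + (intNbrs T s).card - if T.Adj r s then 2 else 0) := by
  rw [dipTwo, excess_add_single, excess_dipOne hT hr, graphLap_dipOne_of_ne hs hrs.symm,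
    dipOne_of_ne hs hrs.symm, degree_eq_card_add_card, T.adj_comm s r]
  push_cast
  split_ifs <;> ring

/-- The interior neighbours of `r` other than `s`. -/
noncomputable def branch (T : SimpleGraph V) (r s : V) : Finset V := (intNbrs T r).erase s

theorem mem_branch {v : V} : v ∈ branch T r s ↔ v ≠ s ∧ v ∉ leaves T ∧ T.Adj r v := by
  rw [branch, Finset.mem_erase, mem_intNbrs]

theorem card_branch (hs : s ∉ leaves T) :
    ((branch T r s).card : ℝ) = (intNbrs T r).card - if T.Adj r s then 1 else 0 := by
  rw [branch]
  split_ifs with h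
  · rw [Finset.cast_card_erase_of_mem (mem_intNbrs.2 ⟨hs, h⟩)]
  · rw [Finset.erase_eq_of_notMem fun h' => h (mem_intNbrs.1 h').2, sub_zero]

theorem branch_union_subset (r s : V) :
    branch T r s ∪ branch T s r ⊆ ((leaves T)ᶜ.erase r).erase s := by
  intro v hv
  rw [Finset.mem_union, mem_branch, mem_branch] at hv
  simp only [Finset.mem_erase, Finset.mem_compl]
  rcases hv with ⟨h1, h2, h3⟩ | ⟨h1, h2, h3⟩
  · exact ⟨h1, h3.ne', h2⟩
  · exact ⟨h3.ne', h1, h2⟩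

theorem card_compl_erase_erase (hr : r ∉ leaves T) (hs : s ∉ leaves T) (hrs : r ≠ s) :
    (((leaves T)ᶜ.erase r).erase s).card = (leaves T)ᶜ.card - 2 := by
  rw [Finset.card_erase_of_mem (by simp [hs, hrs.symm]), Finset.card_erase_of_mem (by simp [hr])]
  omega

end TreeFacts

section UpperBound

variable {V : Type*} [Fintype V] {T : SimpleGraph V} {a n : ℕ} {μ : ℝ} {r s : V}

/-- `T` is one of the three star-like path trees made of two weighted stars with `n + 1`
branches each, joined by an edge. -/
def IsExtremalSLP (T : SimpleGraph V) (a n : ℕ) : Prop :=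
  Nonempty (T ≃g SLP (a + 1) a 1 (n + 1) (n + 1)) ∨
    Nonempty (T ≃g SLP (a + 1) a 2 n (n + 1)) ∨
    Nonempty (T ≃g SLP (a + 1) a 3 n n)

theorem excess_dipOne_neg (hT : T.Connected) (hK : (leaves T)ᶜ.card = 2 * n + 4)
    (hB : (leaves T).card = a * (2 * n + 4) + 2) (hμ0 : 0 < μ) (hμ1 : μ < 1)
    (hμ : μ ^ 2 - (n + 3) * μ + 1 = 0) (hr : r ∉ leaves T) (hLr : a + 2 ≤ (leafNbrs T r).card) :
    excess T (a + μ) (dipOne T μ r) < 0 := by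
  have hN : (intNbrs T r).card ≤ 2 * n + 3 := by
    have h : intNbrs T r ⊆ (leaves T)ᶜ.erase r := fun v hv => by
      rw [mem_intNbrs] at hv
      simp [hv.1, hv.2.ne']
    have := Finset.card_le_card h
    rw [Finset.card_erase_of_mem (by simpa using hr)] at this
    omega
  have hN' : ((intNbrs T r).card : ℝ) ≤ 2 * n + 3 := by exact_mod_cast hN
  have hL' : (a : ℝ) + 2 ≤ (leafNbrs T r).card := by exact_mod_cast hLr
  rw [excess_dipOne hT hr, hK, hB]
  push_cast
  have h1 : 0 ≤ (2 * μ - μ ^ 2) * ((leafNbrs T r).card - a - 2) :=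
    mul_nonneg (by nlinarith) (by linarith)
  have h2 : 0 ≤ μ ^ 2 * (2 * n + 3 - (intNbrs T r).card) :=
    mul_nonneg (by positivity) (by linarith)
  have h3 : 0 < μ ^ 2 * (1 - μ) := mul_pos (by positivity) (by linarith)
  linear_combination h1 + h2 + h3 + (2 - 2 * μ) * hμ

theorem excess_dipTwo_eq (hT : T.Connected) (hK : (leaves T)ᶜ.card = 2 * n + 4)
    (hB : (leaves T).card = a * (2 * n + 4) + 2)
    (hμ : μ ^ 2 - (n + 3) * μ + 1 = 0) (hr : r ∉ leaves T) (hs : s ∉ leaves T) (hrs : r ≠ s)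
    (hLr : (leafNbrs T r).card = a + 1) (hLs : (leafNbrs T s).card = a + 1) :
    excess T (a + μ) (dipTwo T μ r s) =
      μ ^ 2 * ((branch T r s).card + (branch T s r).card - (2 * n + 2)) := by
  rw [excess_dipTwo hT hr hs hrs, hK, hB, hLr, hLs, card_branch hs, card_branch hr, T.adj_comm s r]
  push_cast
  split_ifs <;> linear_combination (2 - 2 * μ) * hμ

theorem card_branch_inter_le (hT : T.IsTree) (hrs : r ≠ s) :
    (branch T r s ∩ branch T s r).card ≤ 1 := by
  refine Finset.card_le_one.2 fun u hu v hv => ?_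
  rw [Finset.mem_inter, mem_branch, mem_branch] at hu hv
  exact hT.common_nbr_unique hrs hu.1.2.2 hu.2.2.2.symm hv.1.2.2 hv.2.2.2.symm

theorem card_eq_of_card_leaves (hK : (leaves T)ᶜ.card = 2 * n + 4)
    (hB : (leaves T).card = a * (2 * n + 4) + 2) :
    Fintype.card V = a * (2 * n + 4) + 2 + (2 * n + 4) := by
  rw [← Finset.card_add_card_compl (leaves T), hK, hB]

theorem isExtremalSLP_of_common_nbr (hT : T.IsTree) (hK : (leaves T)ᶜ.card = 2 * n + 4)
    (hB : (leaves T).card = a * (2 * n + 4) + 2) (hr : r ∉ leaves T)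
    (hLr : (leafNbrs T r).card = a + 1) (hLs : (leafNbrs T s).card = a + 1)
    (hL : ∀ v ∉ leaves T, v ≠ r → v ≠ s → (leafNbrs T v).card = a)
    (hcover : ∀ v ∉ leaves T, v ≠ r → v ≠ s → T.Adj r v ∨ T.Adj s v)
    {t : V} (htr : t ∈ branch T r s) (hts : t ∈ branch T s r)
    (hcr : (branch T r s).card = n + 1) (hcs : (branch T s r).card = n + 2) :
    IsExtremalSLP T a n := by
  refine Or.inr (Or.inl ?_)
  have hqD : ∀ v ∈ branch T r s, (leafNbrs T v).card = a := fun v hv => by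
    rw [mem_branch] at hv
    exact hL v hv.2.1 hv.2.2.ne' hv.1
  have hqE : ∀ v ∈ branch T s r, (leafNbrs T v).card = a := fun v hv => by
    rw [mem_branch] at hv
    exact hL v hv.2.1 hv.1 hv.2.2.ne'
  refine nonempty_iso_SLP hT two_ne_zero ?_ ![r, t, s] ((branch T r s).erase t)
    ((branch T s r).erase t) (by rw [Finset.card_erase_of_mem htr, hcr]; rfl)
    (by rw [Finset.card_erase_of_mem hts, hcs]; rfl) ?_ ?_ ?_ ?_
    (fun v hv => exists_interior_adj_leaf hT.connected ⟨r, by simpa using hr⟩ hv) hLr hLs ?_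
    (fun v hv => hqD v (Finset.mem_of_mem_erase hv))
    (fun v hv => hqE v (Finset.mem_of_mem_erase hv))
  · rw [card_eq_of_card_leaves hK hB, card_slpVert]
    simp
    ring
  · rw [mem_branch] at htr hts
    intro i j h
    fin_cases i <;> fin_cases j <;> simp at h ⊢
    · exact htr.2.2
    · exact hts.2.2.symm
  · intro v hv
    exact (mem_branch.1 (Finset.mem_of_mem_erase hv)).2.2
  · intro v hv
    exact (mem_branch.1 (Finset.mem_of_mem_erase hv)).2.2
  · intro v hv
    by_cases h1 : v = r
    · exact Or.inr (Or.inr ⟨0, h1.symm⟩)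
    by_cases h2 : v = s
    · exact Or.inr (Or.inr ⟨2, h2.symm⟩)
    by_cases h3 : v = t
    · exact Or.inr (Or.inr ⟨1, h3.symm⟩)
    rcases hcover v hv h1 h2 with h | h
    · exact Or.inl (Finset.mem_erase.2 ⟨h3, mem_branch.2 ⟨h2, hv, h⟩⟩)
    · exact Or.inr (Or.inl (Finset.mem_erase.2 ⟨h3, mem_branch.2 ⟨h1, hv, h⟩⟩))
  · intro i
    fin_cases i
    exact hqD t htr

theorem isExtremalSLP_of_partition (hT : T.IsTree) (hK : (leaves T)ᶜ.card = 2 * n + 4)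
    (hB : (leaves T).card = a * (2 * n + 4) + 2) (hr : r ∉ leaves T) (hs : s ∉ leaves T)
    (hrs : r ≠ s) (hLr : (leafNbrs T r).card = a + 1) (hLs : (leafNbrs T s).card = a + 1)
    (hL : ∀ v ∉ leaves T, v ≠ r → v ≠ s → (leafNbrs T v).card = a)
    (hcover : ∀ v ∉ leaves T, v ≠ r → v ≠ s → T.Adj r v ∨ T.Adj s v)
    (hdisj : ∀ v ∉ leaves T, T.Adj r v → ¬ T.Adj s v)
    (hcr : (branch T r s).card = n + 1) (hcs : (branch T s r).card = n + 1) :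
    IsExtremalSLP T a n := by
  have hqD : ∀ v ∈ branch T r s, (leafNbrs T v).card = a := fun v hv => by
    rw [mem_branch] at hv
    exact hL v hv.2.1 hv.2.2.ne' hv.1
  have hqE : ∀ v ∈ branch T s r, (leafNbrs T v).card = a := fun v hv => by
    rw [mem_branch] at hv
    exact hL v hv.2.1 hv.1 hv.2.2.ne'
  have hleaf : ∀ v ∈ leaves T, ∃ u ∉ leaves T, T.Adj u v := fun v hv =>
    exists_interior_adj_leaf hT.connected ⟨r, by simpa using hr⟩ hv
  by_cases hadj : T.Adj r s
  · refine Or.inl (nonempty_iso_SLP hT one_ne_zero ?_ ![r, s] (branch T r s) (branch T s r)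
      hcr hcs ?_ ?_ ?_ ?_ hleaf hLr hLs (fun i => i.elim0) hqD hqE)
    · rw [card_eq_of_card_leaves hK hB, card_slpVert]
      simp
      ring
    · intro i j h
      fin_cases i <;> fin_cases j <;> simp at h ⊢
      exact hadj
    · exact fun v hv => (mem_branch.1 hv).2.2
    · exact fun v hv => (mem_branch.1 hv).2.2
    · intro v hv
      by_cases h1 : v = r
      · exact Or.inr (Or.inr ⟨0, h1.symm⟩)
      by_cases h2 : v = s
      · exact Or.inr (Or.inr ⟨1, h2.symm⟩)
      rcases hcover v hv h1 h2 with h | h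
      · exact Or.inl (mem_branch.2 ⟨h2, hv, h⟩)
      · exact Or.inr (Or.inl (mem_branch.2 ⟨h1, hv, h⟩))
  · obtain ⟨x, y, hx, hy, hxy⟩ : ∃ x y, x ∈ branch T r s ∧ y ∈ branch T s r ∧ T.Adj x y := by
      obtain ⟨x, hx, y, hy, hxy⟩ := exists_boundary_edge hT.connected
        (S := {v | v = r ∨ T.Adj r v ∨ v ∈ leaves T ∧ ∃ u, T.Adj r u ∧ T.Adj u v}) (u := r)
        (v := s) (Or.inl rfl) (by
          rintro (h | h | h)
          · exact hrs h.symm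
          · exact hadj h
          · exact hs h.1)
      have hyr : y ≠ r := fun h => hy (Or.inl h)
      have hnry : ¬ T.Adj r y := fun h => hy (Or.inr (Or.inl h))
      rcases hx with rfl | hx | ⟨hx, u, hru, hux⟩
      · exact (hnry hxy).elim
      · have hxl : x ∉ leaves T := fun h => hyr (eq_of_adj_of_mem_leaves h hxy hx.symm)
        have hyl : y ∉ leaves T := fun h => hy (Or.inr (Or.inr ⟨h, x, hx, hxy⟩))
        have hys : y ≠ s := by
          rintro rfl
          exact hdisj x hxl hx hxy.symm
        have hxs : x ≠ s := by
          rintro rfl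
          exact hadj hx
        exact ⟨x, y, mem_branch.2 ⟨hxs, hxl, hx⟩,
          mem_branch.2 ⟨hyr, hyl, (hcover y hyl hyr hys).resolve_left hnry⟩, hxy⟩
      · exact (hnry (eq_of_adj_of_mem_leaves hx hux.symm hxy ▸ hru)).elim
    refine Or.inr (Or.inr (nonempty_iso_SLP hT three_ne_zero ?_ ![r, x, y, s]
      ((branch T r s).erase x) ((branch T s r).erase y)
      (by rw [Finset.card_erase_of_mem hx, hcr]; rfl)
      (by rw [Finset.card_erase_of_mem hy, hcs]; rfl) ?_ ?_ ?_ ?_ hleaf hLr hLs ?_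
      (fun v hv => hqD v (Finset.mem_of_mem_erase hv))
      (fun v hv => hqE v (Finset.mem_of_mem_erase hv))))
    · rw [card_eq_of_card_leaves hK hB, card_slpVert]
      simp
      ring
    · intro i j h
      fin_cases i <;> fin_cases j <;> simp at h ⊢
      · exact (mem_branch.1 hx).2.2
      · exact hxy
      · exact (mem_branch.1 hy).2.2.symm
    · exact fun v hv => (mem_branch.1 (Finset.mem_of_mem_erase hv)).2.2
    · exact fun v hv => (mem_branch.1 (Finset.mem_of_mem_erase hv)).2.2
    · intro v hv
      by_cases h1 : v = r
      · exact Or.inr (Or.inr ⟨0, h1.symm⟩)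
      by_cases h2 : v = s
      · exact Or.inr (Or.inr ⟨3, h2.symm⟩)
      by_cases h3 : v = x
      · exact Or.inr (Or.inr ⟨1, h3.symm⟩)
      by_cases h4 : v = y
      · exact Or.inr (Or.inr ⟨2, h4.symm⟩)
      rcases hcover v hv h1 h2 with h | h
      · exact Or.inl (Finset.mem_erase.2 ⟨h3, mem_branch.2 ⟨h2, hv, h⟩⟩)
      · exact Or.inr (Or.inl (Finset.mem_erase.2 ⟨h4, mem_branch.2 ⟨h1, hv, h⟩⟩))
    · intro i
      fin_cases i
      · exact hqD x hx
      · exact hqE y hy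

theorem isExtremalSLP_of_dipTwo_minimizer (hT : T.IsTree) (hK : (leaves T)ᶜ.card = 2 * n + 4)
    (hB : (leaves T).card = a * (2 * n + 4) + 2) (hμ0 : 0 < μ) (hμ1 : μ < 1)
    (hμ : μ ^ 2 - (n + 3) * μ + 1 = 0) (hr : r ∉ leaves T) (hs : s ∉ leaves T) (hrs : r ≠ s)
    (hLr : (leafNbrs T r).card = a + 1) (hLs : (leafNbrs T s).card = a + 1)
    (hle : excess T (a + μ) (dipTwo T μ r s) ≤ 0)
    (hnn : ∀ g : V → ℝ, (∀ x ∈ leaves T, g x = 0) → 0 ≤ excess T (a + μ) g) :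
    IsExtremalSLP T a n := by
  have hEL := graphLap_eq_of_excess_nonneg T (leaves T) (a + μ) hnn (dipTwo T μ r s)
    (fun x hx => dipTwo_vanish hr hs hx) hle
  have hgen : ∀ v ∉ leaves T, v ≠ r → v ≠ s → (leafNbrs T v).card = a ∧
      (T.Adj r v ∨ T.Adj s v) ∧ ¬ (T.Adj r v ∧ T.Adj s v) := by
    intro v hv h1 h2
    have h := hEL v hv
    rw [graphLap_dipTwo_of_ne hv h1 h2, dipTwo_of_ne hv h1 h2, T.adj_comm v r, T.adj_comm v s] at h
    by_cases h3 : T.Adj r v <;> by_cases h4 : T.Adj s v <;> simp only [h3, h4, if_true, if_false] at h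
    · have e1 : (leafNbrs T v).card < a := by exact_mod_cast (by linarith : ((leafNbrs T v).card : ℝ) < a)
      have e2 : a < (leafNbrs T v).card + 1 := by
        exact_mod_cast (by linarith : (a : ℝ) < (leafNbrs T v).card + 1)
      omega
    · refine ⟨?_, by simp [h3, h4]⟩
      exact_mod_cast (by linarith : ((leafNbrs T v).card : ℝ) = a)
    · refine ⟨?_, by simp [h3, h4]⟩
      exact_mod_cast (by linarith : ((leafNbrs T v).card : ℝ) = a)
    · have e1 : a < (leafNbrs T v).card := by exact_mod_cast (by linarith : (a : ℝ) < (leafNbrs T v).card)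
      have e2 : (leafNbrs T v).card < a + 1 := by
        exact_mod_cast (by linarith : ((leafNbrs T v).card : ℝ) < a + 1)
      omega
  have hcard : ∀ {r s : V}, r ∉ leaves T → s ∉ leaves T → r ≠ s → (leafNbrs T r).card = a + 1 →
      graphLap T (dipTwo T μ r s) r = (a + μ) * dipTwo T μ r s r →
      (branch T r s).card = n + 1 := by
    intro r s hr hs hrs hLr h
    rw [graphLap_dipTwo_left hr hrs, dipTwo_left hr hrs, hLr] at h
    have h1 : μ * ((branch T r s).card - (n + 1)) = 0 := by
      rw [card_branch hs]
      push_cast at h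
      split_ifs at h ⊢ <;> linear_combination hμ - h
    have h2 : ((branch T r s).card : ℝ) = n + 1 := by
      have := (mul_eq_zero.1 h1).resolve_left hμ0.ne'
      linarith
    exact_mod_cast h2
  refine isExtremalSLP_of_partition hT hK hB hr hs hrs hLr hLs (fun v hv h1 h2 => (hgen v hv h1 h2).1)
    (fun v hv h1 h2 => (hgen v hv h1 h2).2.1) ?_ (hcard hr hs hrs hLr (hEL r hr))
    (hcard hs hr hrs.symm hLs (dipTwo_comm μ r s ▸ hEL s hs))
  intro v hv h1 h2
  exact (hgen v hv h1.ne' h2.ne').2.2 ⟨h1, h2⟩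

end UpperBound

section TwoHubs

variable {V : Type*} [Fintype V] {T : SimpleGraph V} {a n : ℕ} {μ : ℝ} {r s t : V}

/-- The test function on a tree whose hubs `r` and `s` have a common neighbour: it is
`(1 - μ) ^ 2` at `r`, `1 - μ` at `s` and at the interior neighbours of `r`, and `1` elsewhere in
the interior. -/
noncomputable def hubTest (T : SimpleGraph V) (μ : ℝ) (r s v : V) : ℝ :=
  if v ∈ leaves T then 0 else if v = r then (1 - μ) ^ 2 else
    if v = s ∨ T.Adj r v then 1 - μ else 1

theorem hubTest_vanish {x : V} (hx : x ∈ leaves T) : hubTest T μ r s x = 0 := if_pos hx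

theorem hubTest_left (hr : r ∉ leaves T) : hubTest T μ r s r = (1 - μ) ^ 2 := by
  simp [hubTest, hr]

theorem hubTest_right (hs : s ∉ leaves T) (hrs : r ≠ s) : hubTest T μ r s s = 1 - μ := by
  simp [hubTest, hs, hrs.symm]

theorem hubTest_of_adj {v : V} (hv : v ∉ leaves T) (h : T.Adj r v) :
    hubTest T μ r s v = 1 - μ := by
  simp [hubTest, hv, h.ne', h]

theorem hubTest_of_not_adj {v : V} (hv : v ∉ leaves T) (hvr : v ≠ r) (hvs : v ≠ s)
    (h : ¬ T.Adj r v) : hubTest T μ r s v = 1 := by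
  simp [hubTest, hv, hvr, hvs, h]

theorem graphLap_hubTest_of_ne (hT : T.IsTree) (hr : r ∉ leaves T) (hs : s ∉ leaves T)
    (hrs : r ≠ s) (hcover : ∀ v ∉ leaves T, v ≠ r → v ≠ s → T.Adj r v ∨ T.Adj s v)
    (hrt : T.Adj r t) (hst : T.Adj s t) {v : V} (hv : v ∉ leaves T) (hvr : v ≠ r) (hvs : v ≠ s)
    (hLv : (leafNbrs T v).card = a) :
    graphLap T (hubTest T μ r s) v = (a + μ) * hubTest T μ r s v := by
  rw [graphLap_eq_of_vanish (fun x hx => hubTest_vanish hx), hLv]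
  have hnbr : ∀ y ∈ intNbrs T v, y = r ∨ y = s := by
    intro y hy
    rw [mem_intNbrs] at hy
    by_contra! h
    rcases hcover y hy.1 h.1 h.2 with h1 | h1 <;> rcases hcover v hv hvr hvs with h2 | h2
    · exact hT.not_triangle h2 hy.2 h1
    · exact hT.not_pentagon hrs hrt hst.symm h1 h2.symm hy.2.symm
    · exact hT.not_pentagon hrs hrt hst.symm h2 h1.symm hy.2
    · exact hT.not_triangle h2 hy.2 h1
  by_cases h : T.Adj r v
  · rw [hubTest_of_adj hv h]
    have hsum : ∑ y ∈ intNbrs T v, (1 - μ - hubTest T μ r s y) = 1 - μ - (1 - μ) ^ 2 := by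
      rw [Finset.sum_eq_single r, hubTest_left hr]
      · intro y hy hyr
        rw [(hnbr y hy).resolve_left hyr, hubTest_right hs hrs, sub_self]
      · exact fun h' => (h' (mem_intNbrs.2 ⟨hr, h.symm⟩)).elim
    rw [hsum]
    ring
  · have hsv : T.Adj s v := (hcover v hv hvr hvs).resolve_left h
    rw [hubTest_of_not_adj hv hvr hvs h]
    have hsum : ∑ y ∈ intNbrs T v, (1 - hubTest T μ r s y) = 1 - (1 - μ) := by
      rw [Finset.sum_eq_single s, hubTest_right hs hrs]
      · intro y hy hys
        rw [(hnbr y hy).resolve_right hys] at hy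
        exact (h (mem_intNbrs.1 hy).2.symm).elim
      · exact fun h' => (h' (mem_intNbrs.2 ⟨hs, hsv.symm⟩)).elim
    rw [hsum]
    ring

theorem graphLap_hubTest_left (hr : r ∉ leaves T) (hLr : (leafNbrs T r).card = a + 1) :
    graphLap T (hubTest T μ r s) r =
      (a + 1) * (1 - μ) ^ 2 - (intNbrs T r).card * (μ * (1 - μ)) := by
  have hsum : ∑ y ∈ intNbrs T r, ((1 - μ) ^ 2 - hubTest T μ r s y) =
      ∑ y ∈ intNbrs T r, -(μ * (1 - μ)) := by
    refine Finset.sum_congr rfl fun y hy => ?_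
    rw [mem_intNbrs] at hy
    rw [hubTest_of_adj hy.1 hy.2]
    ring
  rw [graphLap_eq_of_vanish (fun x hx => hubTest_vanish hx), hubTest_left hr, hLr, hsum,
    Finset.sum_const, nsmul_eq_mul]
  push_cast
  ring

theorem graphLap_hubTest_right (hT : T.IsTree) (hs : s ∉ leaves T) (hrs : r ≠ s)
    (hLs : (leafNbrs T s).card = a + 1) (ht : t ∉ leaves T)
    (hrt : T.Adj r t) (hst : T.Adj s t) :
    graphLap T (hubTest T μ r s) s = (a + 1) * (1 - μ) - ((intNbrs T s).card - 1) * μ := by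
  have htN : t ∈ intNbrs T s := mem_intNbrs.2 ⟨ht, hst⟩
  have hsum : ∑ y ∈ (intNbrs T s).erase t, (1 - μ - hubTest T μ r s y) =
      ∑ y ∈ (intNbrs T s).erase t, -μ := by
    refine Finset.sum_congr rfl fun y hy => ?_
    rw [Finset.mem_erase, mem_intNbrs] at hy
    rw [hubTest_of_not_adj hy.2.1 _ hy.2.2.ne']
    · ring
    · exact fun h => hy.1 (hT.common_nbr_unique hrs h hy.2.2.symm hrt hst.symm)
    · rintro rfl
      exact hT.not_triangle hst hrt.symm hy.2.2
  rw [graphLap_eq_of_vanish (fun x hx => hubTest_vanish hx), hubTest_right hs hrs, hLs,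
    ← Finset.sum_erase_add _ _ htN, hsum, hubTest_of_adj ht hrt, Finset.sum_const, nsmul_eq_mul,
    Finset.cast_card_erase_of_mem htN]
  push_cast
  ring

theorem excess_hubTest (hT : T.IsTree) (hμ : μ ^ 2 - (n + 3) * μ + 1 = 0) (hr : r ∉ leaves T)
    (hs : s ∉ leaves T) (hrs : r ≠ s) (hLr : (leafNbrs T r).card = a + 1)
    (hLs : (leafNbrs T s).card = a + 1)
    (hL : ∀ v ∉ leaves T, v ≠ r → v ≠ s → (leafNbrs T v).card = a)
    (hcover : ∀ v ∉ leaves T, v ≠ r → v ≠ s → T.Adj r v ∨ T.Adj s v)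
    (ht : t ∉ leaves T) (hrt : T.Adj r t) (hst : T.Adj s t) :
    excess T (a + μ) (hubTest T μ r s) =
      (1 - μ) ^ 3 * μ * (n + 1 - (intNbrs T r).card) +
        (1 - μ) * μ * (n + 2 - (intNbrs T s).card) := by
  rw [excess_eq_sum, Finset.sum_eq_add r s hrs, graphLap_hubTest_left hr hLr,
    graphLap_hubTest_right hT hs hrs hLs ht hrt hst, hubTest_left hr, hubTest_right hs hrs]
  · linear_combination ((1 - μ) ^ 3 + (1 - μ)) * hμ
  · intro v _ hv
    by_cases hvl : v ∈ leaves T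
    · rw [hubTest_vanish hvl, zero_mul]
    · rw [graphLap_hubTest_of_ne hT hr hs hrs hcover hrt hst hvl hv.1 hv.2 (hL v hvl hv.1 hv.2),
        sub_self, mul_zero]
  · simp
  · simp

theorem card_intNbrs_eq_of_inter (hT : T.IsTree) (hK : (leaves T)ᶜ.card = 2 * n + 4)
    (hr : r ∉ leaves T) (hs : s ∉ leaves T) (hrs : r ≠ s)
    (hlt : 2 * n + 2 < (branch T r s).card + (branch T s r).card) :
    (∃ t, t ∈ branch T r s ∧ t ∈ branch T s r) ∧
      (∀ v ∉ leaves T, v ≠ r → v ≠ s → T.Adj r v ∨ T.Adj s v) ∧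
      (branch T r s).card = (intNbrs T r).card ∧ (branch T s r).card = (intNbrs T s).card ∧
      (intNbrs T r).card + (intNbrs T s).card = 2 * n + 3 := by
  have h1 := Finset.card_union_add_card_inter (branch T r s) (branch T s r)
  have h2 := card_branch_inter_le hT hrs
  have h3 := Finset.card_le_card (branch_union_subset (T := T) r s)
  have h4 := card_compl_erase_erase hr hs hrs
  obtain ⟨t, ht⟩ : (branch T r s ∩ branch T s r).Nonempty := by
    rw [← Finset.card_pos]
    omega
  rw [Finset.mem_inter] at ht
  have htr := mem_branch.1 ht.1
  have hts := mem_branch.1 ht.2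
  have hn : ¬ T.Adj r s := hT.not_triangle htr.2.2 hts.2.2.symm
  have hbr : branch T r s = intNbrs T r :=
    Finset.erase_eq_of_notMem fun h => hn (mem_intNbrs.1 h).2
  have hbs : branch T s r = intNbrs T s :=
    Finset.erase_eq_of_notMem fun h => hn (mem_intNbrs.1 h).2.symm
  refine ⟨⟨t, ht⟩, fun v hv hvr hvs => ?_, by rw [hbr], by rw [hbs], by rw [← hbr, ← hbs]; omega⟩
  have hv' : v ∈ branch T r s ∪ branch T s r := by
    rw [Finset.eq_of_subset_of_card_le (branch_union_subset r s) (by omega)]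
    simp [hv, hvr, hvs]
  rw [Finset.mem_union, mem_branch, mem_branch] at hv'
  exact hv'.imp (fun h => h.2.2) fun h => h.2.2

theorem exists_test_of_common_nbr (hT : T.IsTree) (hK : (leaves T)ᶜ.card = 2 * n + 4)
    (hB : (leaves T).card = a * (2 * n + 4) + 2) (hμ0 : 0 < μ) (hμ1 : μ < 1)
    (hμ : μ ^ 2 - (n + 3) * μ + 1 = 0) (hr : r ∉ leaves T) (hs : s ∉ leaves T) (hrs : r ≠ s)
    (hLr : (leafNbrs T r).card = a + 1) (hLs : (leafNbrs T s).card = a + 1)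
    (hL : ∀ v ∉ leaves T, v ≠ r → v ≠ s → (leafNbrs T v).card = a)
    (hlt : 2 * n + 2 < (branch T r s).card + (branch T s r).card)
    (hle : (intNbrs T r).card ≤ (intNbrs T s).card) :
    ∃ f : V → ℝ, (∀ x ∈ leaves T, f x = 0) ∧ f ≠ 0 ∧ excess T (a + μ) f ≤ 0 ∧
      ((∀ g : V → ℝ, (∀ x ∈ leaves T, g x = 0) → 0 ≤ excess T (a + μ) g) →
        IsExtremalSLP T a n) := by
  obtain ⟨⟨t, htr, hts⟩, hcover, hbr, hbs, hN⟩ := card_intNbrs_eq_of_inter hT hK hr hs hrs hlt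
  have htr' := mem_branch.1 htr
  have hts' := mem_branch.1 hts
  have hN' : ((intNbrs T r).card : ℝ) + (intNbrs T s).card = 2 * n + 3 := by exact_mod_cast hN
  have hex := excess_hubTest hT hμ hr hs hrs hLr hLs hL hcover htr'.2.1 htr'.2.2 hts'.2.2
  have hex' : excess T (a + μ) (hubTest T μ r s) =
      ((1 - μ) * μ * (1 - (1 - μ) ^ 2)) * (n + 2 - (intNbrs T s).card) := by
    rw [hex]
    linear_combination (-(1 - μ) ^ 3 * μ) * hN'
  have hpos : 0 < (1 - μ) * μ * (1 - (1 - μ) ^ 2) :=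
    mul_pos (mul_pos (by linarith) hμ0) (by nlinarith)
  have hNs : (n : ℝ) + 2 ≤ (intNbrs T s).card := by
    exact_mod_cast (by omega : n + 2 ≤ (intNbrs T s).card)
  refine ⟨hubTest T μ r s, fun x hx => hubTest_vanish hx, fun h => ?_, ?_, fun hnn => ?_⟩
  · have := congrFun h s
    rw [hubTest_right hs hrs, Pi.zero_apply] at this
    linarith
  · rw [hex']
    exact mul_nonpos_of_nonneg_of_nonpos hpos.le (by linarith)
  · have h0 := hnn (hubTest T μ r s) fun x hx => hubTest_vanish hx
    rw [hex'] at h0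
    have h1 : ((intNbrs T s).card : ℝ) ≤ n + 2 := by
      have := nonneg_of_mul_nonneg_right h0 hpos
      linarith
    have h2 : (intNbrs T s).card ≤ n + 2 := by exact_mod_cast h1
    have h3 : n + 2 ≤ (intNbrs T s).card := by exact_mod_cast hNs
    exact isExtremalSLP_of_common_nbr hT hK hB hr hLr hLs hL hcover htr hts (by omega) (by omega)

theorem exists_test_function (hT : T.IsTree) (hK : (leaves T)ᶜ.card = 2 * n + 4)
    (hB : (leaves T).card = a * (2 * n + 4) + 2) (hμ0 : 0 < μ) (hμ1 : μ < 1)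
    (hμ : μ ^ 2 - (n + 3) * μ + 1 = 0) :
    ∃ f : V → ℝ, (∀ x ∈ leaves T, f x = 0) ∧ f ≠ 0 ∧ excess T (a + μ) f ≤ 0 ∧
      ((∀ g : V → ℝ, (∀ x ∈ leaves T, g x = 0) → 0 ≤ excess T (a + μ) g) →
        IsExtremalSLP T a n) := by
  have hne : (leaves T)ᶜ.Nonempty := Finset.card_pos.1 (by omega)
  by_cases hA : ∃ r ∉ leaves T, a + 2 ≤ (leafNbrs T r).card
  · obtain ⟨r, hr, hLr⟩ := hA
    have hneg := excess_dipOne_neg hT.connected hK hB hμ0 hμ1 hμ hr hLr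
    refine ⟨dipOne T μ r, fun x hx => dipOne_vanish hr hx, fun h => ?_, hneg.le, fun hnn => ?_⟩
    · have := congrFun h r
      rw [dipOne_self hr, Pi.zero_apply] at this
      linarith
    · exact (hneg.not_ge (hnn _ fun x hx => dipOne_vanish hr hx)).elim
  push Not at hA
  set P : Finset V := (leaves T)ᶜ.filter fun v => (leafNbrs T v).card = a + 1 with hPdef
  have hmemP : ∀ {v}, v ∈ P ↔ v ∉ leaves T ∧ (leafNbrs T v).card = a + 1 := by simp [hPdef]
  have hsum := sum_card_leafNbrs hT.connected hne
  rw [hB] at hsum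
  have hPc : 1 < P.card := by
    have h : ∑ v ∈ (leaves T)ᶜ, (leafNbrs T v).card ≤
        ∑ v ∈ (leaves T)ᶜ, (a + if (leafNbrs T v).card = a + 1 then 1 else 0) := by
      refine Finset.sum_le_sum fun v hv => ?_
      have := hA v (by simpa using hv)
      split_ifs <;> omega
    rw [Finset.sum_add_distrib, Finset.sum_const, ← Finset.card_filter, ← hPdef, hK, hsum,
      smul_eq_mul, mul_comm] at h
    omega
  by_cases hB1 : ∃ r ∈ P, ∃ s ∈ P, r ≠ s ∧ (branch T r s).card + (branch T s r).card ≤ 2 * n + 2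
  · obtain ⟨r, hrP, s, hsP, hrs, hle⟩ := hB1
    obtain ⟨hr, hLr⟩ := hmemP.1 hrP
    obtain ⟨hs, hLs⟩ := hmemP.1 hsP
    have hle' : ((branch T r s).card : ℝ) + (branch T s r).card ≤ 2 * n + 2 := by
      exact_mod_cast hle
    have hex : excess T (a + μ) (dipTwo T μ r s) ≤ 0 := by
      rw [excess_dipTwo_eq hT.connected hK hB hμ hr hs hrs hLr hLs]
      exact mul_nonpos_of_nonneg_of_nonpos (sq_nonneg μ) (by linarith)
    refine ⟨dipTwo T μ r s, fun x hx => dipTwo_vanish hr hs hx, fun h => ?_, hex, fun hnn =>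
      isExtremalSLP_of_dipTwo_minimizer hT hK hB hμ0 hμ1 hμ hr hs hrs hLr hLs hex hnn⟩
    have := congrFun h r
    rw [dipTwo_left hr hrs, Pi.zero_apply] at this
    linarith
  push Not at hB1
  have hN : ∀ r ∈ P, ∀ s ∈ P, r ≠ s → (intNbrs T r).card + (intNbrs T s).card = 2 * n + 3 :=
    fun r hr s hs hrs => (card_intNbrs_eq_of_inter hT hK (hmemP.1 hr).1 (hmemP.1 hs).1 hrs
      (hB1 r hr s hs hrs)).2.2.2.2
  obtain ⟨r, hrP, s, hsP, hrs, hle⟩ :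
      ∃ r ∈ P, ∃ s ∈ P, r ≠ s ∧ (intNbrs T r).card ≤ (intNbrs T s).card := by
    obtain ⟨r, hr, s, hs, hrs⟩ := Finset.one_lt_card.1 hPc
    rcases le_total (intNbrs T r).card (intNbrs T s).card with h | h
    · exact ⟨r, hr, s, hs, hrs, h⟩
    · exact ⟨s, hs, r, hr, hrs.symm, h⟩
  obtain ⟨hr, hLr⟩ := hmemP.1 hrP
  obtain ⟨hs, hLs⟩ := hmemP.1 hsP
  have hle_a : ∀ v ∉ leaves T, v ≠ r → v ≠ s → (leafNbrs T v).card ≤ a := by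
    intro v hv hvr hvs
    by_contra! h
    have hvP : v ∈ P := hmemP.2 ⟨hv, by have := hA v hv; omega⟩
    have h1 := hN r hrP s hsP hrs
    have h2 := hN v hvP r hrP hvr
    have h3 := hN v hvP s hsP hvs
    omega
  have hL : ∀ v ∉ leaves T, v ≠ r → v ≠ s → (leafNbrs T v).card = a := by
    have hsr : s ∈ (leaves T)ᶜ.erase r := by simp [hs, hrs.symm]
    rw [← Finset.sum_erase_add _ _ (show r ∈ (leaves T)ᶜ by simpa using hr),
      ← Finset.sum_erase_add _ _ hsr, hLr, hLs] at hsum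
    have hconst : ∑ v ∈ ((leaves T)ᶜ.erase r).erase s, a = a * (2 * n + 2) := by
      rw [Finset.sum_const, card_compl_erase_erase hr hs hrs, hK, smul_eq_mul, mul_comm]
      rfl
    have heq : ∑ v ∈ ((leaves T)ᶜ.erase r).erase s, (leafNbrs T v).card =
        ∑ v ∈ ((leaves T)ᶜ.erase r).erase s, a := by
      rw [hconst]
      linarith
    intro v hv hvr hvs
    refine (Finset.sum_eq_sum_iff_of_le fun v hv => ?_).1 heq v (by simp [hv, hvr, hvs])
    simp only [Finset.mem_erase, Finset.mem_compl] at hv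
    exact hle_a v hv.2.2 hv.2.1 hv.1
  exact exists_test_of_common_nbr hT hK hB hμ0 hμ1 hμ hr hs hrs hLr hLs hL (hB1 r hrP s hsP hrs) hle

end TwoHubs

theorem exists_sigma3_eq_add (a n : ℕ) :
    ∃ μ : ℝ, 0 < μ ∧ μ < 1 ∧ μ ^ 2 - (n + 3) * μ + 1 = 0 ∧ sigma3 a (2 * n + 4) = a + μ := by
  set S := Real.sqrt (((2 * n + 4 : ℕ) + 2 : ℝ) ^ 2 - 16) with hS
  have hn : (0 : ℝ) ≤ n := n.cast_nonneg
  have h2 : S ^ 2 = (2 * n + 6) ^ 2 - 16 := by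
    rw [hS, Real.sq_sqrt]
    · push_cast
      ring
    · push_cast
      nlinarith
  have h0 : 0 ≤ S := Real.sqrt_nonneg _
  have hlt : S < 2 * n + 6 := by nlinarith
  have hgt : 2 * n + 2 < S := by nlinarith
  refine ⟨(2 * n + 6 - S) / 4, by linarith, by linarith, by linear_combination h2 / 16, ?_⟩
  rw [sigma3, ← hS]
  push_cast
  ring

theorem stmt18 {V : Type*} [Fintype V] (a k : ℕ) (ha : 1 ≤ a) (hk : 4 ≤ k) (hke : Even k)
    (T : SimpleGraph V) (hT : T.IsTree)
    (hint : ((leaves T)ᶜ : Finset V).card = k)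
    (hleaf : (leaves T).card = a * k + 2) :
    lambda1 T (leaves T) ≤ sigma3 a k ∧
    (lambda1 T (leaves T) = sigma3 a k ↔
      Nonempty (T ≃g SLP (a + 1) a 1 ((k - 2) / 2) ((k - 2) / 2)) ∨
      Nonempty (T ≃g SLP (a + 1) a 2 ((k - 4) / 2) ((k - 2) / 2)) ∨
      Nonempty (T ≃g SLP (a + 1) a 3 ((k - 4) / 2) ((k - 4) / 2))) := by
  obtain ⟨n, rfl⟩ : ∃ n, k = 2 * n + 4 := by
    obtain ⟨m, rfl⟩ := hke
    exact ⟨m - 2, by omega⟩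
  rw [show (2 * n + 4 - 2) / 2 = n + 1 by omega, show (2 * n + 4 - 4) / 2 = n by omega]
  obtain ⟨μ, hμ0, hμ1, hμ, hσ⟩ := exists_sigma3_eq_add a n
  rw [hσ]
  obtain ⟨f, hf, hne, hle, hext⟩ := exists_test_function hT hint hleaf hμ0 hμ1 hμ
  have hub := lambda1_le_of_excess_nonpos T (leaves T) (a + μ) f hf hne hle
  refine ⟨hub, fun h => hext (excess_nonneg_of_lambda1_eq h), fun h => ?_⟩
  have hd : ((n + 1 : ℕ) : ℝ) * μ ≤ (1 - μ) ^ 2 := by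
    push_cast
    linarith
  refine le_antisymm hub (le_lambda1_of_excess_nonneg T _ _ (Finset.card_pos.1 (by omega)) ?_)
  rcases h with ⟨⟨φ⟩⟩ | ⟨⟨φ⟩⟩ | ⟨⟨φ⟩⟩
  · exact excess_nonneg_of_iso φ fun f hf => excess_SLP_one_nonneg hμ1 hd f hf
  · exact excess_nonneg_of_iso φ fun f hf => excess_SLP_two_nonneg hμ1 hd hd f hf
  · exact excess_nonneg_of_iso φ fun f hf => excess_SLP_three_nonneg hμ1 hd f hf
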